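/- Let combinatorial triangulation data be given with F nonempty and with connected dual graph (the graph on F in which two distinct faces are adjacent if and only if they share an edge), and let Δ : E → ℝ. Then there exists an angle assignment solving the linear program L for Δ — that is, α : C → ℝ with α(c) > 0 for every corner c, Σ_{c ∈ f⁻¹(t)} α(c) = π for every face t, and Σ_{c ∈ o⁻¹(e)} α(c) = Δ(e) for every edge e — if and only if Conditions (2.1) and (2.2) hold. (This is the linear-programming core of Theorem 3.1: when moreover Δ(e) ≤ π for all e, such a solution produces, for each prescribed dilatational holonomy, the unique similarity structure whose Delaunay triangulation is the given complex with dihedral angles Δ.) -/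

import Mathlib

open Finset Real

/-- The set `E(𝓕)` of edges of faces of `𝓕`. -/
def edgesOfFaces {F E C : Type} [Fintype C] [Fintype E] [DecidableEq F] [DecidableEq E]
    (f : C → F) (o : C → E) (𝓕 : Finset F) : Finset E :=
  Finset.univ.filter (fun e => ∃ c, f c ∈ 𝓕 ∧ o c = e)

/-- The excess of a set of faces: `excess(𝓕) = (Σ_{e ∈ E(𝓕)} Δ(e)) − π·|𝓕|`. -/
noncomputable def excess {F E C : Type} [Fintype C] [Fintype E] [DecidableEq F] [DecidableEq E]
    (f : C → F) (o : C → E) (Δ : E → ℝ) (𝓕 : Finset F) : ℝ :=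
  (∑ e ∈ edgesOfFaces f o 𝓕, Δ e) - π * 𝓕.card

open MeasureTheory in
theorem intervalIntegral_indicator_Iic_one {m K y : ℝ} (hm : m ≤ y) (hK : y ≤ K) :
    IntervalIntegrable (fun s : ℝ => if s ≤ y then (1 : ℝ) else 0) volume m K ∧
      ∫ s in m..K, (if s ≤ y then (1 : ℝ) else 0) = y - m := by
  constructor
  · apply Antitone.intervalIntegrable
    intro s t hst
    dsimp only
    split_ifs <;> linarith
  · have h := intervalIntegral.integral_indicator (μ := volume) (f := fun _ : ℝ => (1 : ℝ))
      (show y ∈ Set.Icc m K from ⟨hm, hK⟩)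
    simpa [Set.indicator_apply] using h

/-- Layer-cake comparison: an inequality between the weights of all superlevel sets of two
functions, with equal total weights, gives the inequality between the weighted sums. -/
theorem sum_mul_le_sum_mul_of_superlevel {F E : Type*} [Fintype F] [Fintype E]
    {a x : F → ℝ} {b M : E → ℝ} (hab : ∑ t, a t = ∑ e, b e)
    (h : ∀ s : ℝ, ∑ t, a t * (if s ≤ x t then 1 else 0) ≤
      ∑ e, b e * (if s ≤ M e then 1 else 0)) :
    ∑ t, a t * x t ≤ ∑ e, b e * M e := by
  set K : ℝ := ∑ t, |x t| + ∑ e, |M e| with hKdef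
  have hF : 0 ≤ ∑ t, |x t| := Finset.sum_nonneg fun _ _ => abs_nonneg _
  have hE : 0 ≤ ∑ e, |M e| := Finset.sum_nonneg fun _ _ => abs_nonneg _
  have hx : ∀ t, |x t| ≤ K := fun t => by
    have := Finset.single_le_sum (f := fun t => |x t|) (fun _ _ => abs_nonneg _)
      (Finset.mem_univ t)
    linarith
  have hM : ∀ e, |M e| ≤ K := fun e => by
    have := Finset.single_le_sum (f := fun e => |M e|) (fun _ _ => abs_nonneg _)
      (Finset.mem_univ e)
    linarith
  have hxi := fun t => intervalIntegral_indicator_Iic_one (abs_le.1 (hx t)).1 (abs_le.1 (hx t)).2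
  have hMi := fun e => intervalIntegral_indicator_Iic_one (abs_le.1 (hM e)).1 (abs_le.1 (hM e)).2
  have hmono := intervalIntegral.integral_mono (a := -K) (b := K) (by linarith)
    (IntervalIntegrable.sum Finset.univ fun t _ => (hxi t).1.const_mul (a t))
    (IntervalIntegrable.sum Finset.univ fun e _ => (hMi e).1.const_mul (b e))
    (fun s => by simpa only [Finset.sum_apply] using h s)
  simp only [Finset.sum_apply] at hmono
  rw [intervalIntegral.integral_finsetSum fun t _ => (hxi t).1.const_mul (a t),
    intervalIntegral.integral_finsetSum fun e _ => (hMi e).1.const_mul (b e)] at hmono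
  simp only [intervalIntegral.integral_const_mul, (hxi _).2, (hMi _).2, mul_sub,
    Finset.sum_sub_distrib, ← Finset.sum_mul, hab] at hmono
  linarith

theorem mem_edgesOfFaces {F E C : Type} [Fintype C] [Fintype E] [DecidableEq F] [DecidableEq E]
    {f : C → F} {o : C → E} {𝓕 : Finset F} {e : E} :
    e ∈ edgesOfFaces f o 𝓕 ↔ ∃ c, f c ∈ 𝓕 ∧ o c = e := by
  simp [edgesOfFaces]

/-- A transportation problem whose supplies satisfy the Hall-type inequalities has a nonnegative
solution. -/
theorem exists_nonneg_of_sum_le_sum_edgesOfFaces {F E C : Type}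
    [Fintype F] [Fintype E] [Fintype C] [DecidableEq F] [DecidableEq E] [DecidableEq C]
    (f : C → F) (o : C → E) (ho : Function.Surjective o) (a : F → ℝ) (b : E → ℝ)
    (hb : ∀ e, 0 ≤ b e) (hab : ∑ t, a t = ∑ e, b e)
    (h : ∀ 𝓕 : Finset F, ∑ t ∈ 𝓕, a t ≤ ∑ e ∈ edgesOfFaces f o 𝓕, b e) :
    ∃ β : C → ℝ, (∀ c, 0 ≤ β c) ∧
      (∀ t, ∑ c ∈ Finset.univ.filter (fun c => f c = t), β c = a t) ∧
      (∀ e, ∑ c ∈ Finset.univ.filter (fun c => o c = e), β c = b e) := by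
  set P : Set (C → ℝ) := {β | (∀ c, 0 ≤ β c) ∧
    ∀ e, ∑ c ∈ Finset.univ.filter (fun c => o c = e), β c = b e} with hP
  set R : (C → ℝ) →ₗ[ℝ] (F → ℝ) :=
    LinearMap.pi fun t => ∑ c ∈ Finset.univ.filter (fun c => f c = t), LinearMap.proj c with hR
  have hRapp : ∀ β t, R β t = ∑ c ∈ Finset.univ.filter (fun c => f c = t), β c := by
    intro β t
    simp [hR]
  have hPclosed : IsClosed P := by
    simp only [hP, Set.ofPred_and, Set.ofPred_forall]
    exact (isClosed_iInter fun c => isClosed_le continuous_const (by fun_prop)).inter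
      (isClosed_iInter fun e => isClosed_eq (by fun_prop) continuous_const)
  have hPcompact : IsCompact P := by
    refine (isCompact_Icc (a := (0 : C → ℝ)) (b := fun c => b (o c))).of_isClosed_subset
      hPclosed ?_
    rintro β ⟨hβ, hβe⟩
    refine ⟨fun c => hβ c, fun c => ?_⟩
    dsimp only
    rw [← hβe (o c)]
    exact Finset.single_le_sum (fun c _ => hβ c) (by simp)
  have hPconvex : Convex ℝ P := by
    rintro β ⟨hβ, hβe⟩ γ ⟨hγ, hγe⟩ p q hp hq hpq
    refine ⟨fun c => add_nonneg (mul_nonneg hp (hβ c)) (mul_nonneg hq (hγ c)), fun e => ?_⟩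
    simp only [Pi.add_apply, Pi.smul_apply, smul_eq_mul, Finset.sum_add_distrib,
      ← Finset.mul_sum, hβe, hγe]
    rw [← add_mul, hpq, one_mul]
  by_cases hmem : a ∈ Set.image R P
  · obtain ⟨β, ⟨hβ, hβe⟩, hβa⟩ := hmem
    exact ⟨β, hβ, fun t => by rw [← hRapp, hβa], hβe⟩
  exfalso
  obtain ⟨φ, u, hφ, hu⟩ := geometric_hahn_banach_closed_point (hPconvex.linear_image R)
    (hPcompact.image R.continuous_of_finiteDimensional).isClosed hmem
  set x : F → ℝ := fun t => φ (fun j => if t = j then 1 else 0) with hx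
  have hφx : ∀ v : F → ℝ, φ v = ∑ t, v t * x t := by
    intro v
    have := LinearMap.pi_apply_eq_sum_univ (φ : (F → ℝ) →ₗ[ℝ] ℝ) v
    simpa [hx] using this
  have hmax : ∀ e, ∃ c, o c = e ∧ ∀ c', o c' = e → x (f c') ≤ x (f c) := by
    intro e
    obtain ⟨c₀, hc₀⟩ := ho e
    obtain ⟨c, hc, hcmax⟩ := Finset.exists_max_image
      (Finset.univ.filter (fun c => o c = e)) (fun c => x (f c)) ⟨c₀, by simpa using hc₀⟩
    exact ⟨c, by simpa using hc, fun c' hc' => hcmax c' (by simpa using hc')⟩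
  choose g hg hgmax using hmax
  set β : C → ℝ := fun c => if c = g (o c) then b (o c) else 0 with hβ
  have hfiber : ∀ (y : C → ℝ) e,
      ∑ c ∈ Finset.univ.filter (fun c => o c = e), β c * y c = b e * y (g e) := by
    intro y e
    rw [Finset.sum_eq_single (g e)]
    · simp [hβ, hg]
    · intro c hc hne
      have hc' : o c = e := by simpa using hc
      simp [hβ, hc', hne]
    · intro hc
      simp [hg] at hc
  have hβP : β ∈ P := by
    refine ⟨fun c => ?_, fun e => by simpa using hfiber (fun _ => 1) e⟩
    simp only [hβ]
    split_ifs
    exacts [hb _, le_rfl]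
  have hvalue : φ (R β) = ∑ e, b e * x (f (g e)) := by
    rw [hφx]
    calc ∑ t, R β t * x t = ∑ t, ∑ c ∈ Finset.univ.filter (fun c => f c = t), β c * x (f c) := by
          refine Finset.sum_congr rfl fun t _ => ?_
          rw [hRapp, Finset.sum_mul]
          refine Finset.sum_congr rfl fun c hc => ?_
          rw [(Finset.mem_filter.1 hc).2]
      _ = ∑ c, β c * x (f c) := Finset.sum_fiberwise _ f _
      _ = ∑ e, ∑ c ∈ Finset.univ.filter (fun c => o c = e), β c * x (f c) :=
          (Finset.sum_fiberwise _ o _).symm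
      _ = ∑ e, b e * x (f (g e)) := Finset.sum_congr rfl fun e _ => hfiber (fun c => x (f c)) e
  have hle : ∑ t, a t * x t ≤ ∑ e, b e * x (f (g e)) := by
    refine sum_mul_le_sum_mul_of_superlevel hab fun s => ?_
    have hs := h (Finset.univ.filter fun t => s ≤ x t)
    have hedges : edgesOfFaces f o (Finset.univ.filter fun t => s ≤ x t) =
        Finset.univ.filter fun e => s ≤ x (f (g e)) := by
      ext e
      simp only [mem_edgesOfFaces, Finset.mem_filter, Finset.mem_univ, true_and]
      exact ⟨fun ⟨c, hc, hce⟩ => hc.trans (hgmax e c hce), fun he => ⟨g e, he, hg e⟩⟩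
    rw [hedges] at hs
    simpa [Finset.sum_filter] using hs
  have := hφ (R β) ⟨β, hβP, rfl⟩
  rw [hvalue] at this
  rw [hφx] at hu
  linarith

/-- In a connected graph whose adjacency comes from sharing edges, every nonempty proper set of
faces has an edge that also has a corner in a face outside the set. -/
theorem exists_corner_notMem_of_connected {F E C : Type} [Fintype F] [Fintype E] [Fintype C]
    [DecidableEq F] [DecidableEq E] {f : C → F} {o : C → E}
    (hconn : (SimpleGraph.fromRel (fun t t' : F =>
        ∃ e : E, (∃ c, f c = t ∧ o c = e) ∧ (∃ c, f c = t' ∧ o c = e))).Connected)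
    {𝓕 : Finset F} (hne : 𝓕.Nonempty) (hproper : 𝓕 ≠ Finset.univ) :
    ∃ c, o c ∈ edgesOfFaces f o 𝓕 ∧ f c ∉ 𝓕 := by
  obtain ⟨t, ht⟩ := hne
  obtain ⟨t', ht'⟩ : ∃ t', t' ∉ 𝓕 := by
    by_contra! hall
    exact hproper (Finset.eq_univ_iff_forall.2 hall)
  obtain ⟨p⟩ := hconn.preconnected t t'
  obtain ⟨d, -, hd, hd'⟩ := p.exists_boundary_dart (𝓕 : Set F) ht ht'
  have hadj := d.adj
  rw [SimpleGraph.fromRel_adj] at hadj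
  obtain ⟨-, ⟨e, ⟨c, hc, hce⟩, c', hc', hce'⟩ | ⟨e, ⟨c', hc', hce'⟩, c, hc, hce⟩⟩ := hadj
  all_goals
    refine ⟨c', mem_edgesOfFaces.2 ⟨c, ?_, hce.trans hce'.symm⟩, ?_⟩
    · rw [hc]; exact hd
    · rw [hc']; exact hd'

/-- The excess of `𝓕` is the sum of the angles opposite to edges of `𝓕` in faces outside `𝓕`. -/
theorem excess_eq_sum {F E C : Type} [Fintype F] [Fintype E] [Fintype C]
    [DecidableEq F] [DecidableEq E] {f : C → F} {o : C → E} {Δ : E → ℝ} {α : C → ℝ}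
    (hf : ∀ t : F, ∑ c ∈ Finset.univ.filter (fun c => f c = t), α c = π)
    (ho : ∀ e : E, ∑ c ∈ Finset.univ.filter (fun c => o c = e), α c = Δ e) (𝓕 : Finset F) :
    excess f o Δ 𝓕 =
      ∑ c ∈ Finset.univ.filter (fun c => o c ∈ edgesOfFaces f o 𝓕 ∧ f c ∉ 𝓕), α c := by
  have hΔ : ∑ e ∈ edgesOfFaces f o 𝓕, Δ e =
      ∑ c ∈ Finset.univ.filter (fun c => o c ∈ edgesOfFaces f o 𝓕), α c := by
    simp only [← ho]
    exact Finset.sum_fiberwise_eq_sum_filter _ _ _ _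
  have hπ : π * 𝓕.card = ∑ c ∈ Finset.univ.filter (fun c => f c ∈ 𝓕), α c := by
    rw [← Finset.sum_fiberwise_eq_sum_filter, Finset.sum_congr rfl fun t _ => hf t]
    simp [mul_comm]
  have hsub : (Finset.univ.filter fun c => o c ∈ edgesOfFaces f o 𝓕).filter (fun c => f c ∈ 𝓕) =
      Finset.univ.filter fun c => f c ∈ 𝓕 := by
    ext c
    simp only [Finset.mem_filter, Finset.mem_univ, true_and, and_iff_right_iff_imp]
    exact fun hc => mem_edgesOfFaces.2 ⟨c, hc, rfl⟩
  rw [excess, hΔ, hπ, ← hsub, ← Finset.sum_filter_add_sum_filter_not _ (fun c => f c ∈ 𝓕),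
    add_sub_cancel_left, Finset.filter_filter]

/-- **Linear-programming core of Theorem 3.1.** For combinatorial triangulation data with
nonempty face set and connected dual graph, the linear program `L` for `Δ` (strictly
positive angles, each face summing to `π`, each edge summing to `Δ(e)`) has a solution if
and only if Conditions 2.1 and 2.2 hold. -/
theorem linear_program_solvable_iff
    (F E C : Type) [Fintype F] [Fintype E] [Fintype C]
    [DecidableEq F] [DecidableEq E] [DecidableEq C]
    (f : C → F) (o : C → E)
    (hface : ∀ t : F, (Finset.univ.filter (fun c => f c = t)).card = 3)
    (hedge : ∀ e : E, (Finset.univ.filter (fun c => o c = e)).card = 1 ∨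
                      (Finset.univ.filter (fun c => o c = e)).card = 2)
    (hFne : Nonempty F)
    -- connectedness of the dual graph: two distinct faces are adjacent iff they share an edge
    (hconn : (SimpleGraph.fromRel (fun t t' : F =>
        ∃ e : E, (∃ c, f c = t ∧ o c = e) ∧ (∃ c, f c = t' ∧ o c = e))).Connected)
    (Δ : E → ℝ) :
    (∃ α : C → ℝ,
      (∀ c : C, 0 < α c) ∧
      (∀ t : F, ∑ c ∈ Finset.univ.filter (fun c => f c = t), α c = π) ∧
      (∀ e : E, ∑ c ∈ Finset.univ.filter (fun c => o c = e), α c = Δ e)) ↔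
    ((∀ e : E, 0 < Δ e) ∧
     (∀ 𝓕 : Finset F, 𝓕.Nonempty → 𝓕 ≠ Finset.univ → 0 < excess f o Δ 𝓕) ∧
     excess f o Δ (Finset.univ : Finset F) = 0) := by
  have ho : Function.Surjective o := by
    intro e
    have : 0 < (Finset.univ.filter (fun c => o c = e)).card := by have := hedge e; omega
    obtain ⟨c, hc⟩ := Finset.card_pos.1 this
    exact ⟨c, by simpa using hc⟩
  constructor
  · rintro ⟨α, hpos, hαf, hαo⟩
    refine ⟨fun e => ?_, fun 𝓕 hne hproper => ?_, ?_⟩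
    · obtain ⟨c, hc⟩ := ho e
      rw [← hαo e]
      exact Finset.sum_pos (fun c _ => hpos c) ⟨c, by simpa using hc⟩
    · rw [excess_eq_sum hαf hαo]
      obtain ⟨c, hc⟩ := exists_corner_notMem_of_connected hconn hne hproper
      exact Finset.sum_pos (fun c _ => hpos c) ⟨c, by simpa using hc⟩
    · simp [excess_eq_sum hαf hαo]
  · rintro ⟨hΔ, hexc, huniv⟩
    set n : E → ℝ := fun e => ((Finset.univ.filter (fun c => o c = e)).card : ℝ) with hn
    have hedges : edgesOfFaces f o (Finset.univ : Finset F) = Finset.univ := by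
      ext e
      simpa [mem_edgesOfFaces] using ho e
    have hcount : ∑ e, n e = 3 * Fintype.card F := by
      have hE : ∑ e, (Finset.univ.filter (fun c => o c = e)).card = Fintype.card C :=
        (Finset.card_eq_sum_card_fiberwise (s := Finset.univ) (t := Finset.univ) (by simp)).symm
      have hF : ∑ t, (Finset.univ.filter (fun c => f c = t)).card = Fintype.card C :=
        (Finset.card_eq_sum_card_fiberwise (s := Finset.univ) (t := Finset.univ) (by simp)).symm
      simp only [hface, Finset.sum_const, Finset.card_univ, smul_eq_mul] at hF
      simp only [hn]
      rw [← Nat.cast_sum, hE, ← hF]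
      push_cast
      ring
    -- Lowering every angle by a small `ε` keeps the strict inequalities.
    obtain ⟨ε, ⟨hεΔ, hεexc⟩, hε⟩ : ∃ ε : ℝ, ((∀ e, 0 < Δ e - ε * n e) ∧
        ∀ 𝓕 : Finset F, 𝓕.Nonempty → 𝓕 ≠ Finset.univ →
          0 < excess f o Δ 𝓕 - ε * (∑ e ∈ edgesOfFaces f o 𝓕, n e - 3 * 𝓕.card)) ∧ 0 < ε := by
      have small : ∀ {p : ℝ} (q : ℝ), 0 < p → ∀ᶠ ε in nhdsWithin (0 : ℝ) (Set.Ioi 0),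
          0 < p - ε * q := fun {p} q hp =>
        nhdsWithin_le_nhds (((by fun_prop : Continuous fun ε : ℝ => p - ε * q).tendsto 0
          |>.eventually_const_lt (by simpa using hp)))
      have h₁ := Filter.eventually_all.2 fun e => small (n e) (hΔ e)
      have h₂ := Filter.eventually_all.2 fun 𝓕 : Finset F =>
        Filter.eventually_imp_distrib_left.2 fun hne : 𝓕.Nonempty =>
        Filter.eventually_imp_distrib_left.2 fun hproper : 𝓕 ≠ Finset.univ =>
          small (∑ e ∈ edgesOfFaces f o 𝓕, n e - 3 * 𝓕.card) (hexc 𝓕 hne hproper)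
      exact ((h₁.and h₂).and self_mem_nhdsWithin).exists
    obtain ⟨β, hβ, hβf, hβo⟩ := exists_nonneg_of_sum_le_sum_edgesOfFaces f o ho
      (fun _ => π - 3 * ε) (fun e => Δ e - ε * n e) (fun e => (hεΔ e).le)
      (by
        simp only [excess, hedges, Finset.card_univ] at huniv
        simp only [Finset.sum_sub_distrib, ← Finset.mul_sum, hcount, Finset.sum_const,
          Finset.card_univ, nsmul_eq_mul]
        linarith)
      (by
        intro 𝓕
        simp only [Finset.sum_sub_distrib, ← Finset.mul_sum, Finset.sum_const, nsmul_eq_mul]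
        rcases 𝓕.eq_empty_or_nonempty with rfl | hne
        · simp [edgesOfFaces]
        by_cases hproper : 𝓕 = Finset.univ
        · subst hproper
          simp only [excess, hedges, Finset.card_univ] at huniv
          simp only [hedges, hcount, Finset.card_univ]
          linarith
        · have := hεexc 𝓕 hne hproper
          simp only [excess] at this
          linarith)
    refine ⟨fun c => β c + ε, fun c => add_pos_of_nonneg_of_pos (hβ c) hε, fun t => ?_,
      fun e => ?_⟩
    · rw [Finset.sum_add_distrib, hβf, Finset.sum_const, hface]
      simp
    · rw [Finset.sum_add_distrib, hβo, Finset.sum_const]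
      simp only [hn, nsmul_eq_mul]
      ring
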